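/- (Correctness of binary-search lookup, corresponding to the search loop of the running example) If isBST t holds, then for every integer k, lookup t k = Map t k. -/

import Mathlib

namespace ScopeLogicBST

/-- Binary trees whose nodes carry an integer key and integer data. -/
inductive T : Type where
  | leaf : T
  | node : T → T → ℤ → ℤ → T

/-- The key set of a tree. -/
def Dom : T → Finset ℤ
  | .leaf => ∅
  | .node l r K _ => {K} ∪ Dom l ∪ Dom r

/-- The finite map defined only at `K`, with value `D`. -/
def single (K D : ℤ) : ℤ → Option ℤ := fun k => if k = K then some D else none

/-- Right-biased override of finite maps. -/
def ovr (M M' : ℤ → Option ℤ) : ℤ → Option ℤ := fun k =>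
  match M' k with
  | some v => some v
  | none => M k

infixl:65 " † " => ovr

/-- The finite map retrieved from a tree. -/
def Map : T → ℤ → Option ℤ
  | .leaf => fun _ => none
  | .node l r K D => (single K D † Map l) † Map r

/-- Binary-search-tree property. -/
def isBST : T → Prop
  | .leaf => True
  | .node l r K _ =>
      isBST l ∧ isBST r ∧ (∀ k ∈ Dom l, k < K) ∧ (∀ k ∈ Dom r, K < k)

end ScopeLogicBST

namespace ScopeLogicBST

/-- Comparison-driven binary search, mirroring the search loop of the program. -/
def lookup : T → ℤ → Option ℤ
  | .leaf, _ => none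
  | .node l r K D, k =>
      if k < K then lookup l k
      else if K < k then lookup r k
      else some D

end ScopeLogicBST

namespace ScopeLogicBST

theorem ovr_of_eq_none {M M' : ℤ → Option ℤ} {k : ℤ} (h : M' k = none) :
    (M † M') k = M k := by
  simp [ovr, h]

theorem ovr_of_left_eq_none {M M' : ℤ → Option ℤ} {k : ℤ} (h : M k = none) :
    (M † M') k = M' k := by
  unfold ovr
  cases h' : M' k <;> simp [h]

theorem map_eq_none_of_notMem_dom {t : T} {k : ℤ} (h : k ∉ Dom t) : Map t k = none := by
  induction t with
  | leaf => rfl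
  | node l r K D ihl ihr =>
    simp only [Dom, Finset.mem_union, Finset.mem_singleton, not_or] at h
    obtain ⟨⟨hK, hl⟩, hr⟩ := h
    rw [Map, ovr_of_eq_none (ihr hr), ovr_of_eq_none (ihl hl), single, if_neg hK]

end ScopeLogicBST

open ScopeLogicBST

theorem lookup_eq_map (t : T) (hbst : isBST t) :
    ∀ k : ℤ, lookup t k = Map t k := by
  induction t with
  | leaf => exact fun _ => rfl
  | node l r K D ihl ihr =>
    obtain ⟨hl, hr, hlK, hKr⟩ := hbst
    intro k
    rw [lookup, Map]
    split_ifs with h₁ h₂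
    · have hkr : k ∉ Dom r := fun h => (hKr k h).not_gt h₁
      rw [ovr_of_eq_none (map_eq_none_of_notMem_dom hkr),
        ovr_of_left_eq_none (if_neg h₁.ne), ihl hl]
    · have hkl : k ∉ Dom l := fun h => (hlK k h).not_gt h₂
      rw [ovr_of_left_eq_none, ihr hr]
      rw [ovr_of_eq_none (map_eq_none_of_notMem_dom hkl), single, if_neg h₂.ne']
    · obtain rfl : k = K := le_antisymm (not_lt.mp h₂) (not_lt.mp h₁)
      have hkl : k ∉ Dom l := fun h => (hlK k h).false
      have hkr : k ∉ Dom r := fun h => (hKr k h).false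
      rw [ovr_of_eq_none (map_eq_none_of_notMem_dom hkr),
        ovr_of_eq_none (map_eq_none_of_notMem_dom hkl), single, if_pos rfl]
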